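/- Let C be a pretriangulated category and let X⊤ and X⊥ be two sequences of objects of C, X⊤₀ and X⊥₀ being zero objects, equipped with morphisms X⊤_i ⟶ X⊤_{i+1} and X⊥_i ⟶ X⊥_{i+1} for all i. Suppose there are objects G_i and distinguished triangles X⊤_i ⟶ X⊤_{i+1} ⟶ G_i ⟶ X⊤_i⟦1⟧ and X⊥_i ⟶ X⊥_{i+1} ⟶ G_i ⟶ X⊥_i⟦1⟧ with the same third object G_i for every i. Then [X⊤_k] = [X⊥_k] in K₀(C) for all k ∈ ℕ. -/

import Mathlib

open CategoryTheory CategoryTheory.Limits CategoryTheory.Pretriangulated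

universe v u

variable (C : Type u) [Category.{v} C] [HasZeroObject C] [Preadditive C]
  [HasShift C ℤ] [∀ n : ℤ, (shiftFunctor C n).Additive] [Pretriangulated C]

/-- The isomorphism class of an object. -/
def isoCls (X : C) : Quotient (isIsomorphicSetoid C) :=
  Quotient.mk (isIsomorphicSetoid C) X

/-- The subgroup of relations defining `K₀` of a pretriangulated category:
for every distinguished triangle `X₁ ⟶ X₂ ⟶ X₃ ⟶ X₁⟦1⟧` we impose
`[X₂] = [X₁] + [X₃]`. -/
def K0Rels : AddSubgroup (FreeAbelianGroup (Quotient (isIsomorphicSetoid C))) :=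
  AddSubgroup.closure
    { x | ∃ T : Triangle C, (T ∈ distTriang C) ∧
        x = FreeAbelianGroup.of (isoCls C T.obj₂) - FreeAbelianGroup.of (isoCls C T.obj₁) -
          FreeAbelianGroup.of (isoCls C T.obj₃) }

/-- `K₀` of a pretriangulated category: the free abelian group on isomorphism classes
of objects, modulo the relation `[X₂] = [X₁] + [X₃]` for every distinguished triangle. -/
abbrev K0 : Type u :=
  FreeAbelianGroup (Quotient (isIsomorphicSetoid C)) ⧸ K0Rels C

/-- The class of an object of `C` in `K₀ C`. -/
def K0.mk (X : C) : K0 C :=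
  QuotientAddGroup.mk (FreeAbelianGroup.of (isoCls C X))


/-- Isomorphic objects have equal classes in `K₀`. -/
theorem K0.mk_eq_of_iso {X Y : C} (e : X ≅ Y) : K0.mk C X = K0.mk C Y := by
  have h : isoCls C X = isoCls C Y := Quotient.sound ⟨e⟩
  simp only [K0.mk, h]

/-- Classes in `K₀` are additive on distinguished triangles. -/
theorem K0.mk_obj₂ {T : Triangle C} (hT : T ∈ distTriang C) :
    K0.mk C T.obj₂ = K0.mk C T.obj₁ + K0.mk C T.obj₃ := by
  have h : FreeAbelianGroup.of (isoCls C T.obj₂) - FreeAbelianGroup.of (isoCls C T.obj₁) -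
      FreeAbelianGroup.of (isoCls C T.obj₃) ∈ K0Rels C :=
    AddSubgroup.subset_closure ⟨T, hT, rfl⟩
  rw [← QuotientAddGroup.eq_zero_iff, QuotientAddGroup.mk_sub, QuotientAddGroup.mk_sub,
    sub_sub, sub_eq_zero] at h
  exact h

/-- If two sequences of objects, starting at zero objects and equipped with structure maps,
admit distinguished triangles with the same third objects `G i`, then the corresponding
filtration stages have equal classes in `K₀`. -/
theorem k0_eq_of_graded_eq
    (Xtop Xbot : ℕ → C) (hXtop : IsZero (Xtop 0)) (hXbot : IsZero (Xbot 0))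
    (t : ∀ i, Xtop i ⟶ Xtop (i + 1)) (b : ∀ i, Xbot i ⟶ Xbot (i + 1))
    (G : ℕ → C)
    (htop : ∀ i, ∃ (g : Xtop (i + 1) ⟶ G i) (h : G i ⟶ (Xtop i)⟦(1 : ℤ)⟧),
      Triangle.mk (t i) g h ∈ distTriang C)
    (hbot : ∀ i, ∃ (g : Xbot (i + 1) ⟶ G i) (h : G i ⟶ (Xbot i)⟦(1 : ℤ)⟧),
      Triangle.mk (b i) g h ∈ distTriang C)
    (k : ℕ) :
    K0.mk C (Xtop k) = K0.mk C (Xbot k) := by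
  induction k with
  | zero => exact K0.mk_eq_of_iso C (hXtop.iso hXbot)
  | succ k ih =>
    obtain ⟨_, _, h_top⟩ := htop k
    obtain ⟨_, _, h_bot⟩ := hbot k
    calc K0.mk C (Xtop (k + 1)) = K0.mk C (Xtop k) + K0.mk C (G k) := K0.mk_obj₂ C h_top
      _ = K0.mk C (Xbot k) + K0.mk C (G k) := by rw [ih]
      _ = K0.mk C (Xbot (k + 1)) := (K0.mk_obj₂ C h_bot).symm
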